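/- arXiv:1305.6402 — 2 statements merged into one kernel-verified Lean document; each statement's English description precedes it below -/
import Mathlib

section
/- Let H be a real symmetric positive definite s×s matrix, G a real r×s matrix, S a real r×d matrix, and W ∈ ℝʳ. Let X₀ = {z ∈ ℝᵈ : ∃U, GU ≤ W + Sz} and for z ∈ X₀ let U⁰(z) denote the unique minimizer of (1/2)UᵀHU over {U : GU ≤ W + Sz}. Then the map z ↦ U⁰(z) is continuous on X₀. -/
open Matrix

namespace PQP
open Filter Topology

/-- Expansion of the quadratic form. -/
lemma quad_expand {s : ℕ} {H : Matrix (Fin s) (Fin s) ℝ} (hH : H.PosDef)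
    (U D : Fin s → ℝ) (t : ℝ) :
    (U + t • D) ⬝ᵥ H *ᵥ (U + t • D)
      = U ⬝ᵥ H *ᵥ U + 2 * t * (D ⬝ᵥ H *ᵥ U) + t ^ 2 * (D ⬝ᵥ H *ᵥ D) := by
  have hsymm : U ⬝ᵥ H *ᵥ D = D ⬝ᵥ H *ᵥ U := by
    have hT : Hᵀ = H := by simpa [Matrix.IsHermitian] using hH.1
    rw [Matrix.dotProduct_mulVec, ← Matrix.mulVec_transpose, hT, dotProduct_comm]
  simp only [Matrix.mulVec_add, Matrix.mulVec_smul, add_dotProduct, dotProduct_add,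
    smul_dotProduct, dotProduct_smul, smul_eq_mul, hsymm]
  ring

lemma quad_pos {s : ℕ} {H : Matrix (Fin s) (Fin s) ℝ} (hH : H.PosDef)
    (D : Fin s → ℝ) (h : D ⬝ᵥ H *ᵥ D ≤ 0) : D = 0 := by
  by_contra hne
  have := hH.dotProduct_mulVec_pos hne
  simp only [star_trivial] at this
  linarith

/-- The optimality condition determines the minimizer. -/
lemma eq_of_variational {s : ℕ} {H : Matrix (Fin s) (Fin s) ℝ} (hH : H.PosDef)
    (U V : Fin s → ℝ) (h : 0 ≤ (U - V) ⬝ᵥ H *ᵥ V)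
    (hle : U ⬝ᵥ H *ᵥ U ≤ V ⬝ᵥ H *ᵥ V) : U = V := by
  have e := quad_expand hH V (U - V) 1
  have hv : V + (1 : ℝ) • (U - V) = U := by simp
  rw [hv] at e
  have := quad_pos hH (U - V) (by linarith)
  exact sub_eq_zero.mp this

/-- First-order necessary condition at the minimizer, on the active set. -/
lemma variational {s r : ℕ} {H : Matrix (Fin s) (Fin s) ℝ} (hH : H.PosDef)
    (G : Matrix (Fin r) (Fin s) ℝ) (b : Fin r → ℝ) (U : Fin s → ℝ)
    (hU : G *ᵥ U ≤ b)
    (hmin : ∀ V : Fin s → ℝ, G *ᵥ V ≤ b → U ⬝ᵥ H *ᵥ U ≤ V ⬝ᵥ H *ᵥ V)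
    (D : Fin s → ℝ) (hD : ∀ i, (G *ᵥ U) i = b i → (G *ᵥ D) i ≤ 0) :
    0 ≤ D ⬝ᵥ H *ᵥ U := by
  have hfeas : ∀ᶠ t : ℝ in 𝓝[>] 0, ∀ i, (G *ᵥ U) i + t * (G *ᵥ D) i ≤ b i := by
    rw [eventually_all]
    intro i
    by_cases hi : (G *ᵥ U) i = b i
    · filter_upwards [self_mem_nhdsWithin] with t ht
      have ht' : (0 : ℝ) < t := ht
      have := mul_nonpos_of_nonneg_of_nonpos ht'.le (hD i hi)
      linarith
    · have hlt : (G *ᵥ U) i < b i := lt_of_le_of_ne (hU i) hi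
      have hc : Tendsto (fun t : ℝ => (G *ᵥ U) i + t * (G *ᵥ D) i) (𝓝[>] 0)
          (𝓝 ((G *ᵥ U) i + 0 * (G *ᵥ D) i)) := by
        apply Tendsto.mono_left _ nhdsWithin_le_nhds
        exact Continuous.tendsto (by fun_prop) 0
      have := hc.eventually_lt_const (u := b i) (by simpa using hlt)
      exact this.mono fun t ht => ht.le
  have hev : ∀ᶠ t : ℝ in 𝓝[>] 0, 0 ≤ 2 * (D ⬝ᵥ H *ᵥ U) + t * (D ⬝ᵥ H *ᵥ D) := by
    filter_upwards [hfeas, self_mem_nhdsWithin] with t ht hpos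
    have hpos' : (0 : ℝ) < t := hpos
    have h1 := hmin (U + t • D) (by
      intro i
      simpa [Matrix.mulVec_add, Matrix.mulVec_smul] using ht i)
    rw [quad_expand hH] at h1
    have h2 : 0 ≤ t * (2 * (D ⬝ᵥ H *ᵥ U) + t * (D ⬝ᵥ H *ᵥ D)) := by nlinarith
    exact nonneg_of_mul_nonneg_right h2 hpos'
  have hc : Tendsto (fun t : ℝ => 2 * (D ⬝ᵥ H *ᵥ U) + t * (D ⬝ᵥ H *ᵥ D)) (𝓝[>] 0)
      (𝓝 (2 * (D ⬝ᵥ H *ᵥ U) + 0 * (D ⬝ᵥ H *ᵥ D))) := by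
    apply Tendsto.mono_left _ nhdsWithin_le_nhds
    exact Continuous.tendsto (by fun_prop) 0
  have := ge_of_tendsto hc hev
  linarith

/-- For a set `A` of active constraints, the candidate minimizer is a linear function
of the active right-hand side. -/
lemma exists_affine {s r : ℕ} {H : Matrix (Fin s) (Fin s) ℝ} (hH : H.PosDef)
    (G : Matrix (Fin r) (Fin s) ℝ) (A : Set (Fin r)) :
    ∃ L : (Fin r → ℝ) → (Fin s → ℝ), Continuous L ∧
      ∀ (b : Fin r → ℝ) (U : Fin s → ℝ), (∀ i ∈ A, (G *ᵥ U) i = b i) →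
        (∀ D : Fin s → ℝ, (∀ i ∈ A, (G *ᵥ D) i ≤ 0) → 0 ≤ D ⬝ᵥ H *ᵥ U) → L b = U := by
  classical
  let P : (Fin r → ℝ) →ₗ[ℝ] (Fin r → ℝ) :=
    LinearMap.pi fun i => if i ∈ A then LinearMap.proj i else 0
  have hP : ∀ b i, P b i = if i ∈ A then b i else 0 := by
    intro b i
    by_cases h : i ∈ A <;> simp [P, h]
  let M : Submodule ℝ (Fin s → ℝ) :=
    { carrier := {U | ∀ D : Fin s → ℝ, (∀ i ∈ A, (G *ᵥ D) i = 0) → D ⬝ᵥ H *ᵥ U = 0}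
      add_mem' := by
        intro U V hU hV D hD
        rw [Matrix.mulVec_add, dotProduct_add, hU D hD, hV D hD, add_zero]
      zero_mem' := by
        intro D hD
        simp
      smul_mem' := by
        intro c U hU D hD
        rw [Matrix.mulVec_smul, dotProduct_smul, hU D hD, smul_zero] }
  let T : M →ₗ[ℝ] (Fin r → ℝ) := P ∘ₗ G.mulVecLin ∘ₗ M.subtype
  have hT : LinearMap.ker T = ⊥ := by
    rw [LinearMap.ker_eq_bot']
    rintro ⟨U, hU⟩ h0
    have h1 : ∀ i ∈ A, (G *ᵥ U) i = 0 := by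
      intro i hi
      have h2 : P (G *ᵥ U) i = 0 := congrFun h0 i
      rw [hP, if_pos hi] at h2
      exact h2
    have := quad_pos hH U (hU U h1).le
    exact Subtype.ext this
  obtain ⟨g, hg⟩ := T.exists_leftInverse_of_injective hT
  let L : (Fin r → ℝ) →ₗ[ℝ] (Fin s → ℝ) := M.subtype ∘ₗ g ∘ₗ P
  refine ⟨L, L.continuous_of_finiteDimensional, ?_⟩
  intro b U hb hvar
  have hUM : U ∈ M := by
    intro D hD
    have h1 := hvar D fun i hi => (hD i hi).le
    have h2 := hvar (-D) fun i hi => by simp [Matrix.mulVec_neg, hD i hi]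
    rw [neg_dotProduct] at h2
    linarith
  have hTb : P b = T ⟨U, hUM⟩ := by
    change P b = P (G *ᵥ U)
    funext i
    rw [hP, hP]
    by_cases hi : i ∈ A
    · rw [if_pos hi, if_pos hi, hb i hi]
    · rw [if_neg hi, if_neg hi]
  have h3 : g (P b) = ⟨U, hUM⟩ := by
    rw [hTb]
    exact LinearMap.congr_fun hg _
  change ((g (P b) : M) : Fin s → ℝ) = U
  rw [h3]

end PQP

/-- The unique minimizer `U⁰(z)` of `(1/2)UᵀHU` (with `H ≻ 0`)
over `{U : GU ≤ W + Sz}` depends continuously on the parameter `z` over the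
feasible parameter set `X₀ = {z | ∃U, GU ≤ W + Sz}`. -/
theorem parametric_qp_minimizer_continuous (s r d : ℕ)
    (H : Matrix (Fin s) (Fin s) ℝ) (hH : H.PosDef)
    (G : Matrix (Fin r) (Fin s) ℝ) (S : Matrix (Fin r) (Fin d) ℝ)
    (W : Fin r → ℝ)
    (U0 : (Fin d → ℝ) → (Fin s → ℝ))
    (hU0 : ∀ z : Fin d → ℝ, (∃ U : Fin s → ℝ, G.mulVec U ≤ W + S.mulVec z) →
      G.mulVec (U0 z) ≤ W + S.mulVec z ∧
      ∀ U : Fin s → ℝ, G.mulVec U ≤ W + S.mulVec z →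
        (1 / 2) * ((U0 z) ⬝ᵥ H.mulVec (U0 z)) ≤ (1 / 2) * (U ⬝ᵥ H.mulVec U)) :
    ContinuousOn U0 {z : Fin d → ℝ | ∃ U : Fin s → ℝ, G.mulVec U ≤ W + S.mulVec z} := by
  classical
  choose L hLc hL using fun A : Set (Fin r) => PQP.exists_affine hH G A
  let f : Set (Fin r) → (Fin d → ℝ) → (Fin s → ℝ) := fun A z => L A (W + S *ᵥ z)
  have hbc : Continuous fun z : Fin d → ℝ => W + S *ᵥ z :=
    continuous_const.add (continuous_const.matrix_mulVec continuous_id)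
  have hf : ∀ A, Continuous (f A) := fun A => (hLc A).comp hbc
  have hGf : ∀ A, Continuous fun z => G *ᵥ f A z := fun A =>
    continuous_const.matrix_mulVec (hf A)
  let K : Set (Fin r) → Set (Fin d → ℝ) := fun A =>
    {z | G *ᵥ f A z ≤ W + S *ᵥ z} ∩
    ({z | ∀ i ∈ A, (G *ᵥ f A z) i = (W + S *ᵥ z) i} ∩
    {z | ∀ D : Fin s → ℝ, (∀ i ∈ A, (G *ᵥ D) i ≤ 0) → 0 ≤ D ⬝ᵥ H *ᵥ f A z})
  have hKc : ∀ A, IsClosed (K A) := by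
    intro A
    refine (isClosed_le (hGf A) hbc).inter (IsClosed.inter ?_ ?_)
    · simp only [Set.setOf_forall]
      exact isClosed_iInter fun i => isClosed_iInter fun _ =>
        isClosed_eq ((continuous_apply i).comp (hGf A)) ((continuous_apply i).comp hbc)
    · simp only [Set.setOf_forall]
      exact isClosed_iInter fun D => isClosed_iInter fun _ =>
        isClosed_le continuous_const
          (continuous_const.dotProduct (continuous_const.matrix_mulVec (hf A)))
  have hKf : ∀ A, ∀ z ∈ K A, U0 z = f A z := by
    rintro A z ⟨h1, h2, h3⟩
    obtain ⟨h4, h5⟩ := hU0 z ⟨_, h1⟩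
    refine PQP.eq_of_variational hH _ _ (h3 _ fun i hi => ?_) ?_
    · have := h4 i
      rw [Matrix.mulVec_sub, Pi.sub_apply, h2 i hi]
      linarith
    · have := h5 _ h1
      linarith
  have hcov : {z : Fin d → ℝ | ∃ U : Fin s → ℝ, G.mulVec U ≤ W + S.mulVec z} ⊆ ⋃ A, K A := by
    intro z hz
    obtain ⟨h4, h5⟩ := hU0 z hz
    let A : Set (Fin r) := {i | (G *ᵥ U0 z) i = (W + S *ᵥ z) i}
    have hv : ∀ D : Fin s → ℝ, (∀ i ∈ A, (G *ᵥ D) i ≤ 0) → 0 ≤ D ⬝ᵥ H *ᵥ U0 z := by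
      intro D hD
      refine PQP.variational hH G _ (U0 z) h4 (fun V hV => ?_) D hD
      have := h5 V hV
      linarith
    have he : f A z = U0 z := hL A _ (U0 z) (fun i hi => hi) hv
    refine Set.mem_iUnion.2 ⟨A, ?_, ?_, ?_⟩
    · change G *ᵥ f A z ≤ _
      rw [he]; exact h4
    · change ∀ i ∈ A, (G *ᵥ f A z) i = _
      rw [he]; exact fun i hi => hi
    · change ∀ D : Fin s → ℝ, (∀ i ∈ A, (G *ᵥ D) i ≤ 0) → 0 ≤ D ⬝ᵥ H *ᵥ f A z
      rw [he]; exact hv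
  refine ContinuousOn.mono ?_ hcov
  exact (locallyFinite_of_finite K).continuousOn_iUnion hKc fun A =>
    (hf A).continuousOn.congr (hKf A)
end

section
/- Let H be a real symmetric positive definite s×s matrix, G a real r×s matrix, S a real r×d matrix, and W ∈ ℝʳ. Let X₀ = {z ∈ ℝᵈ : ∃U, GU ≤ W + Sz} and for z ∈ X₀ let U⁰(z) be the unique minimizer of (1/2)UᵀHU over {U : GU ≤ W + Sz}. Then there exist finitely many regions, i.e. matrices H¹,…,H^{N_r}, vectors k¹,…,k^{N_r}, matrices F¹,…,F^{N_r} and vectors g¹,…,g^{N_r}, such that the polyhedra CRⁱ = {z : Hⁱz ≤ kⁱ} ∩ X₀ cover X₀ and U⁰(z) = Fⁱ z + gⁱ for every z ∈ CRⁱ, i = 1,…,N_r; that is, U⁰ is piecewise affine on a finite polyhedral partition of X₀. -/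
open Matrix

theorem pqp_farkas {ι E : Type*} [DecidableEq ι] [AddCommGroup E] [Module ℝ E] (A : Finset ι) :
    ∀ (a : ι → E →ₗ[ℝ] ℝ) (b : E →ₗ[ℝ] ℝ),
      (∀ x, (∀ i ∈ A, a i x ≤ 0) → b x ≤ 0) →
      ∃ l : ι → ℝ, (∀ i, 0 ≤ l i) ∧ (∀ i, i ∉ A → l i = 0) ∧ b = ∑ i ∈ A, l i • a i := by
  induction A using Finset.induction_on with
  | empty =>
    intro a b h
    refine ⟨fun _ => 0, by simp, by simp, ?_⟩
    ext x
    have h1 := h x (by simp)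
    have h2 := h (-x) (by simp)
    simp at h2
    simp
    linarith
  | insert n A hn ih =>
    intro a b h
    by_cases hc : ∀ x, (∀ i ∈ A, a i x ≤ 0) → b x ≤ 0
    · obtain ⟨l, h0, h1, h2⟩ := ih a b hc
      refine ⟨l, h0, fun i hi => h1 i (fun h => hi (Finset.mem_insert_of_mem h)), ?_⟩
      rw [Finset.sum_insert hn, h1 n hn, zero_smul, zero_add, h2]
    · push Not at hc
      obtain ⟨x1, hx1, hb1⟩ := hc
      have hp : 0 < a n x1 := by
        by_contra hle
        have := h x1 (by
          intro i hi
          rcases Finset.mem_insert.1 hi with rfl | hi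
          · linarith
          · exact hx1 i hi)
        linarith
      obtain ⟨x0, hx0, hb0, hn0⟩ : ∃ x0, (∀ i ∈ A, a i x0 ≤ 0) ∧ 0 < b x0 ∧ a n x0 = 1 := by
        refine ⟨(a n x1)⁻¹ • x1, ?_, ?_, ?_⟩
        · intro i hi
          simp only [map_smul, smul_eq_mul]
          exact mul_nonpos_of_nonneg_of_nonpos (by positivity) (hx1 i hi)
        · simp only [map_smul, smul_eq_mul]; positivity
        · simp only [map_smul, smul_eq_mul]; field_simp
      obtain ⟨l, h0, h1, h2⟩ := ih (fun i => a i - a i x0 • a n) (b - b x0 • a n) (by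
        intro x hx
        have := h (x - a n x • x0) (by
          intro i hi
          rcases Finset.mem_insert.1 hi with rfl | hi
          · simp [hn0]
          · have := hx i hi
            simp at this ⊢
            linarith)
        simp at this ⊢
        linarith)
      refine ⟨Function.update l n (b x0 - ∑ i ∈ A, l i * a i x0), ?_, ?_, ?_⟩
      · intro i
        by_cases hi : i = n
        · subst hi
          simp only [Function.update_self]
          have : ∑ i ∈ A, l i * a i x0 ≤ 0 := Finset.sum_nonpos (fun i hi =>
            mul_nonpos_of_nonneg_of_nonpos (h0 i) (hx0 i hi))
          linarith
        · rw [Function.update_of_ne hi]; exact h0 i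
      · intro i hi
        rw [Finset.mem_insert, not_or] at hi
        rw [Function.update_of_ne hi.1]; exact h1 i hi.2
      · rw [Finset.sum_insert hn]
        have : ∑ i ∈ A, Function.update l n (b x0 - ∑ i ∈ A, l i * a i x0) i • a i
            = ∑ i ∈ A, l i • a i := by
          refine Finset.sum_congr rfl (fun i hi => ?_)
          rw [Function.update_of_ne]
          rintro rfl; exact hn hi
        rw [this]
        ext x
        have h3 := congrArg (fun f : E →ₗ[ℝ] ℝ => f x) h2
        simp [mul_sub, Finset.sum_sub_distrib] at h3 ⊢
        rw [sub_mul, Finset.sum_mul]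
        simp only [mul_assoc]
        linarith

theorem pqp_poly {ι : Type*} [Fintype ι] (d : ℕ) (f : ι → (Fin d → ℝ) →ᵃ[ℝ] ℝ) :
    ∃ (n : ℕ) (M : Matrix (Fin n) (Fin d) ℝ) (k : Fin n → ℝ),
      ∀ z, M.mulVec z ≤ k ↔ ∀ i, f i z ≤ 0 := by
  let e := Fintype.equivFin ι
  refine ⟨Fintype.card ι, LinearMap.toMatrix' (LinearMap.pi fun j => (f (e.symm j)).linear),
    fun j => - f (e.symm j) 0, fun z => ?_⟩
  rw [LinearMap.toMatrix'_mulVec, Pi.le_def, ← e.symm.forall_congr_right]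
  refine forall_congr' fun j => ?_
  have := congrFun (AffineMap.decomp (f (e.symm j))) z
  simp at this
  rw [this]
  simp
  constructor <;> intro h <;> linarith

noncomputable def pqpT {s r : ℕ} (H : Matrix (Fin s) (Fin s) ℝ) (G : Matrix (Fin r) (Fin s) ℝ)
    (B : Finset (Fin r)) : ((Fin s → ℝ) × (Fin r → ℝ)) →ₗ[ℝ] ((Fin s → ℝ) × (Fin r → ℝ)) :=
  LinearMap.prod
    (H.mulVecLin ∘ₗ LinearMap.fst ℝ _ _ + Gᵀ.mulVecLin ∘ₗ LinearMap.snd ℝ _ _)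
    (LinearMap.pi fun i => if i ∈ B then LinearMap.proj i ∘ₗ G.mulVecLin ∘ₗ LinearMap.fst ℝ _ _
      else LinearMap.proj i ∘ₗ LinearMap.snd ℝ _ _)

noncomputable def pqpM (s : ℕ) {r : ℕ} (B : Finset (Fin r)) :
    (Fin r → ℝ) →ₗ[ℝ] ((Fin s → ℝ) × (Fin r → ℝ)) :=
  LinearMap.prod 0 (LinearMap.pi fun i => if i ∈ B then LinearMap.proj i else 0)

theorem pqpT_eq {s r : ℕ} (H : Matrix (Fin s) (Fin s) ℝ) (G : Matrix (Fin r) (Fin s) ℝ)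
    (B : Finset (Fin r)) (V : Fin s → ℝ) (l : Fin r → ℝ) (w : Fin r → ℝ) :
    pqpT H G B (V, l) = pqpM s B w ↔
      H.mulVec V + Gᵀ.mulVec l = 0 ∧ (∀ i ∈ B, G.mulVec V i = w i) ∧ (∀ i, i ∉ B → l i = 0) := by
  rw [Prod.ext_iff, funext_iff (f := (pqpT H G B (V, l)).2)]
  refine and_congr Iff.rfl ?_
  rw [← forall_and]
  refine forall_congr' fun i => ?_
  by_cases hi : i ∈ B <;> simp [pqpT, pqpM, hi]

theorem pqp_quad {s : ℕ} (H : Matrix (Fin s) (Fin s) ℝ) (hH : H.PosDef) (V D : Fin s → ℝ) :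
    (V + D) ⬝ᵥ H.mulVec (V + D) = V ⬝ᵥ H.mulVec V + 2 * (D ⬝ᵥ H.mulVec V) + D ⬝ᵥ H.mulVec D := by
  have hs : Hᵀ = H := by simpa using hH.isHermitian.eq
  have : V ⬝ᵥ H.mulVec D = D ⬝ᵥ H.mulVec V := by
    rw [Matrix.dotProduct_mulVec, ← Matrix.mulVec_transpose, hs, dotProduct_comm]
  rw [Matrix.mulVec_add, add_dotProduct, dotProduct_add, dotProduct_add, this]
  ring

theorem pqp_pos {s : ℕ} (H : Matrix (Fin s) (Fin s) ℝ) (hH : H.PosDef) (D : Fin s → ℝ)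
    (h : D ⬝ᵥ H.mulVec D ≤ 0) : D = 0 := by
  by_contra hne
  have := hH.dotProduct_mulVec_pos hne
  simp at this
  linarith

theorem pqp_GT {s r : ℕ} (G : Matrix (Fin r) (Fin s) ℝ) (D : Fin s → ℝ) (l : Fin r → ℝ) :
    D ⬝ᵥ Gᵀ.mulVec l = ∑ i, l i * G.mulVec D i := by
  rw [Matrix.mulVec_transpose, dotProduct_comm, ← Matrix.dotProduct_mulVec]
  rfl

/-- KKT points are minimizers. -/
theorem pqp_suff {s r : ℕ} (H : Matrix (Fin s) (Fin s) ℝ) (hH : H.PosDef)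
    (G : Matrix (Fin r) (Fin s) ℝ) (B : Finset (Fin r)) (V U : Fin s → ℝ) (l w : Fin r → ℝ)
    (hT : pqpT H G B (V, l) = pqpM s B w) (hl : ∀ i, 0 ≤ l i)
    (hU : G.mulVec U ≤ w) (hq : U ⬝ᵥ H.mulVec U ≤ V ⬝ᵥ H.mulVec V) : U = V := by
  obtain ⟨h1, h2, h3⟩ := (pqpT_eq H G B V l w).1 hT
  have hD : U = V + (U - V) := by abel
  have hquad := pqp_quad H hH V (U - V)
  rw [← hD] at hquad
  have h4 : (U - V) ⬝ᵥ H.mulVec V = - ∑ i, l i * G.mulVec (U - V) i := by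
    rw [eq_neg_of_add_eq_zero_left h1, dotProduct_neg, pqp_GT]
  have h5 : ∑ i, l i * G.mulVec (U - V) i ≤ 0 := by
    refine Finset.sum_nonpos fun i _ => ?_
    by_cases hi : i ∈ B
    · refine mul_nonpos_of_nonneg_of_nonpos (hl i) ?_
      rw [Matrix.mulVec_sub, Pi.sub_apply, h2 i hi]
      linarith [hU i]
    · simp [h3 i hi]
  exact sub_eq_zero.1 (pqp_pos H hH (U - V) (by linarith))

/-- Existence of multipliers. -/
theorem pqp_kkt {s r : ℕ} (H : Matrix (Fin s) (Fin s) ℝ) (hH : H.PosDef)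
    (G : Matrix (Fin r) (Fin s) ℝ) (V : Fin s → ℝ) (w : Fin r → ℝ)
    (hV : G.mulVec V ≤ w)
    (hmin : ∀ U, G.mulVec U ≤ w → V ⬝ᵥ H.mulVec V ≤ U ⬝ᵥ H.mulVec U) :
    ∃ l : Fin r → ℝ, (∀ i, 0 ≤ l i) ∧ (∀ i, l i ≠ 0 → G.mulVec V i = w i) ∧
      H.mulVec V + Gᵀ.mulVec l = 0 := by
  classical
  let A : Finset (Fin r) := Finset.univ.filter fun i => G.mulVec V i = w i
  obtain ⟨l, h0, h1, h2⟩ := pqp_farkas A (fun i => LinearMap.proj i ∘ₗ G.mulVecLin)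
    (-(dotProductBilin ℝ ℝ (H.mulVec V))) (by
      intro D hD
      have hev : ∀ᶠ t : ℝ in nhdsWithin 0 (Set.Ioi 0), ∀ i, G.mulVec (V + t • D) i ≤ w i := by
        rw [Filter.eventually_all]
        intro i
        by_cases hi : G.mulVec V i = w i
        · filter_upwards [self_mem_nhdsWithin] with t ht
          have h := hD i (by simp [A, hi])
          simp at h
          rw [Matrix.mulVec_add, Matrix.mulVec_smul, Pi.add_apply, Pi.smul_apply, hi, smul_eq_mul]
          have := mul_nonpos_of_nonneg_of_nonpos (le_of_lt ht) h
          linarith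
        · have hlt : G.mulVec V i < w i := lt_of_le_of_ne (hV i) hi
          have hc : Filter.Tendsto (fun t : ℝ => G.mulVec V i + t * G.mulVec D i)
              (nhdsWithin 0 (Set.Ioi 0)) (nhds (G.mulVec V i + 0 * G.mulVec D i)) :=
            (Continuous.tendsto (by fun_prop) 0).mono_left nhdsWithin_le_nhds
          filter_upwards [hc.eventually_lt_const (by simpa using hlt)] with t ht
          rw [Matrix.mulVec_add, Matrix.mulVec_smul, Pi.add_apply, Pi.smul_apply, smul_eq_mul]
          exact ht.le
      have hev2 : ∀ᶠ t : ℝ in nhdsWithin 0 (Set.Ioi 0),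
          0 ≤ 2 * (D ⬝ᵥ H.mulVec V) + t * (D ⬝ᵥ H.mulVec D) := by
        filter_upwards [hev, self_mem_nhdsWithin] with t ht htp
        have h := hmin _ ht
        rw [pqp_quad H hH, Matrix.mulVec_smul, smul_dotProduct, smul_dotProduct,
          dotProduct_smul] at h
        simp only [smul_eq_mul] at h
        have htp' : (0:ℝ) < t := htp
        refine le_of_mul_le_mul_left ?_ htp'
        linarith
      have hc : Filter.Tendsto (fun t : ℝ => 2 * (D ⬝ᵥ H.mulVec V) + t * (D ⬝ᵥ H.mulVec D))
              (nhdsWithin 0 (Set.Ioi 0)) (nhds (2 * (D ⬝ᵥ H.mulVec V) + 0 * (D ⬝ᵥ H.mulVec D))) :=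
            (Continuous.tendsto (by fun_prop) 0).mono_left nhdsWithin_le_nhds
      have := ge_of_tendsto hc hev2
      have hcm := dotProduct_comm D (H.mulVec V)
      simp
      linarith)
  refine ⟨l, h0, ?_, ?_⟩
  · intro i hi
    by_contra hne
    exact hi (h1 i (by simp [A, hne]))
  · refine dotProduct_eq_zero _ fun D => ?_
    have h3 := congrArg (fun f : (Fin s → ℝ) →ₗ[ℝ] ℝ => f D) h2
    simp at h3
    rw [dotProduct_comm, dotProduct_add, pqp_GT, dotProduct_comm]
    rw [← Finset.sum_subset (Finset.subset_univ A) (by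
      intro i _ hi; rw [h1 i hi, zero_mul])]
    linarith

theorem pqp_reduce {r : ℕ} (l m : Fin r → ℝ) (hl : ∀ i, 0 ≤ l i)
    (hm : ∀ i, l i = 0 → m i = 0) (hp : ∃ i, 0 < m i) :
    ∃ t : ℝ, (∀ i, 0 ≤ l i - t * m i) ∧ ∃ i, l i ≠ 0 ∧ l i - t * m i = 0 := by
  classical
  obtain ⟨i0, hi0⟩ := hp
  obtain ⟨j, hj, hjm⟩ := Finset.exists_min_image (Finset.univ.filter fun i => 0 < m i)
    (fun i => l i / m i) ⟨i0, by simpa using hi0⟩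
  simp at hj hjm
  refine ⟨l j / m j, fun i => ?_, j, fun h => hj.ne' (hm j h), by field_simp; simp⟩
  by_cases hi : 0 < m i
  · have := hjm i hi
    rw [le_div_iff₀ hi] at this
    linarith
  · have : l j / m j * m i ≤ 0 :=
      mul_nonpos_of_nonneg_of_nonpos (div_nonneg (hl j) hj.le) (not_lt.1 hi)
    linarith [hl i]

theorem pqp_indep {s r : ℕ} (H : Matrix (Fin s) (Fin s) ℝ) (hH : H.PosDef)
    (G : Matrix (Fin r) (Fin s) ℝ) (V : Fin s → ℝ) (w : Fin r → ℝ)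
    (hV : G.mulVec V ≤ w)
    (hmin : ∀ U, G.mulVec U ≤ w → V ⬝ᵥ H.mulVec V ≤ U ⬝ᵥ H.mulVec U) :
    ∃ (B : Finset (Fin r)) (l : Fin r → ℝ), (∀ i, 0 ≤ l i) ∧
      pqpT H G B (V, l) = pqpM s B w ∧ Function.Injective (pqpT H G B) := by
  classical
  let K : Set (Fin r → ℝ) := {l | (∀ i, 0 ≤ l i) ∧ (∀ i, l i ≠ 0 → G.mulVec V i = w i) ∧
      H.mulVec V + Gᵀ.mulVec l = 0}
  let c : (Fin r → ℝ) → ℕ := fun l => (Finset.univ.filter fun i => l i ≠ 0).card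
  have hK : K.Nonempty := pqp_kkt H hH G V w hV hmin
  let l := Function.argminOn c K hK
  have hlK : l ∈ K := Function.argminOn_mem c K hK
  have hlm : ∀ m ∈ K, c l ≤ c m := fun m hm => Function.argminOn_le c K hm
  clear_value l
  obtain ⟨h0, h1, h2⟩ := hlK
  have key : ∀ m : Fin r → ℝ, Gᵀ.mulVec m = 0 → (∀ i, l i = 0 → m i = 0) → ¬ ∃ i, 0 < m i := by
    intro m hG hm hp
    obtain ⟨t, ht, j, hj, hj0⟩ := pqp_reduce l m h0 hm hp
    have hmem : (l - t • m) ∈ K := by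
      refine ⟨fun i => by simpa using ht i, fun i hi => h1 i fun h => hi ?_, ?_⟩
      · simp [h, hm i h]
      · rw [Matrix.mulVec_sub, Matrix.mulVec_smul, hG, smul_zero, sub_zero, h2]
    have := hlm _ hmem
    refine absurd this (not_le.2 (Finset.card_lt_card ?_))
    refine (Finset.ssubset_iff_of_subset ?_).2 ⟨j, by simpa using hj, by simpa using hj0⟩
    intro i hi
    simp at hi ⊢
    intro h
    exact hi (by simp [h, hm i h])
  refine ⟨Finset.univ.filter fun i => l i ≠ 0, l, h0, ?_, ?_⟩
  · rw [pqpT_eq]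
    exact ⟨h2, fun i hi => h1 i (by simpa using hi), fun i hi => by simpa using hi⟩
  · rw [injective_iff_map_eq_zero]
    rintro ⟨D, m⟩ h
    rw [← map_zero (pqpM s _), pqpT_eq] at h
    obtain ⟨e1, e2, e3⟩ := h
    simp at e2 e3
    have hD : D = 0 := by
      refine pqp_pos H hH D (le_of_eq ?_)
      rw [eq_neg_of_add_eq_zero_left e1, dotProduct_neg, pqp_GT, neg_eq_zero]
      refine Finset.sum_eq_zero fun i _ => ?_
      by_cases hi : l i = 0
      · simp [e3 i hi]
      · simp [e2 i hi]
    subst hD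
    simp only [Matrix.mulVec_zero, zero_add] at e1
    have k1 := key m e1 e3
    have k2 := key (-m) (by rw [Matrix.mulVec_neg, e1, neg_zero]) (fun i hi => by simp [e3 i hi])
    push Not at k1 k2
    have : m = 0 := by
      ext i
      have a := k1 i
      have b := k2 i
      simp at b
      exact le_antisymm a b
    rw [this]; rfl

/-- For each `B` a polyhedral region on which the minimizer is affine. -/
theorem pqp_region {s r : ℕ} (d : ℕ) (H : Matrix (Fin s) (Fin s) ℝ)
    (G : Matrix (Fin r) (Fin s) ℝ) (S : Matrix (Fin r) (Fin d) ℝ) (W : Fin r → ℝ)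
    (B : Finset (Fin r)) :
    ∃ (n : ℕ) (M : Matrix (Fin n) (Fin d) ℝ) (k : Fin n → ℝ)
      (F : Matrix (Fin s) (Fin d) ℝ) (g : Fin s → ℝ),
      (∀ z, M.mulVec z ≤ k → G.mulVec (F.mulVec z + g) ≤ W + S.mulVec z ∧ ∃ l, (∀ i, 0 ≤ l i) ∧
        pqpT H G B (F.mulVec z + g, l) = pqpM s B (W + S.mulVec z)) ∧
      (Function.Injective (pqpT H G B) → ∀ z V l, (∀ i, 0 ≤ l i) → G.mulVec V ≤ W + S.mulVec z →
        pqpT H G B (V, l) = pqpM s B (W + S.mulVec z) → M.mulVec z ≤ k) := by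
  obtain ⟨L, hL⟩ : ∃ L : ((Fin s → ℝ) × (Fin r → ℝ)) →ₗ[ℝ] ((Fin s → ℝ) × (Fin r → ℝ)),
      Function.Injective (pqpT H G B) → ∀ p, L (pqpT H G B p) = p := by
    by_cases h : Function.Injective (pqpT H G B)
    · obtain ⟨L, hL⟩ := LinearMap.exists_leftInverse_of_injective _ (LinearMap.ker_eq_bot.2 h)
      exact ⟨L, fun _ p => congrArg (fun f => f p) hL⟩
    · exact ⟨0, fun h' => absurd h' h⟩
  let w : (Fin d → ℝ) →ᵃ[ℝ] (Fin r → ℝ) := AffineMap.const ℝ _ W + S.mulVecLin.toAffineMap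
  have hw : ∀ z, w z = W + S.mulVec z := fun z => by simp [w]
  let q := (pqpM s B).toAffineMap.comp w
  let p := L.toAffineMap.comp q
  let e := (pqpT H G B).toAffineMap.comp p - q
  let e1 : Fin s → (Fin d → ℝ) →ᵃ[ℝ] ℝ := fun i =>
    (LinearMap.proj i ∘ₗ LinearMap.fst ℝ (Fin s → ℝ) (Fin r → ℝ)).toAffineMap.comp e
  let e2 : Fin r → (Fin d → ℝ) →ᵃ[ℝ] ℝ := fun i =>
    (LinearMap.proj i ∘ₗ LinearMap.snd ℝ (Fin s → ℝ) (Fin r → ℝ)).toAffineMap.comp e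
  let e3 : Fin r → (Fin d → ℝ) →ᵃ[ℝ] ℝ := fun i =>
    (-(LinearMap.proj i ∘ₗ LinearMap.snd ℝ (Fin s → ℝ) (Fin r → ℝ))).toAffineMap.comp p
  let e4 : Fin r → (Fin d → ℝ) →ᵃ[ℝ] ℝ := fun i =>
    (LinearMap.proj i ∘ₗ G.mulVecLin ∘ₗ LinearMap.fst ℝ (Fin s → ℝ) (Fin r → ℝ)).toAffineMap.comp p
      - (LinearMap.proj i : (Fin r → ℝ) →ₗ[ℝ] ℝ).toAffineMap.comp w
  obtain ⟨n, M, k, hM⟩ := pqp_poly d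
    (Sum.elim (Sum.elim (Sum.elim e1 (-e1)) (Sum.elim e2 (-e2))) (Sum.elim e3 e4))
  have hM' : ∀ z, M.mulVec z ≤ k ↔ (pqpT H G B (p z) = pqpM s B (W + S.mulVec z) ∧
      (∀ i, 0 ≤ (p z).2 i) ∧ G.mulVec (p z).1 ≤ W + S.mulVec z) := by
    intro z
    rw [hM, ← hw]
    have h1 : ∀ i, e1 i z = (pqpT H G B (p z)).1 i - (pqpM s B (w z)).1 i := fun i => rfl
    have h2 : ∀ i, e2 i z = (pqpT H G B (p z)).2 i - (pqpM s B (w z)).2 i := fun i => rfl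
    have h3 : ∀ i, e3 i z = -(p z).2 i := fun i => rfl
    have h6 : ∀ i, e4 i z = G.mulVec (p z).1 i - w z i := fun i => rfl
    have h4 : ∀ i, (-e1) i z = -(e1 i z) := fun i => rfl
    have h5 : ∀ i, (-e2) i z = -(e2 i z) := fun i => rfl
    simp only [Sum.forall, Sum.elim_inl, Sum.elim_inr, h4, h5]
    simp only [h1, h2, h3, h6]
    rw [Prod.ext_iff, funext_iff, funext_iff, Pi.le_def]
    constructor
    · rintro ⟨⟨⟨a, b⟩, a', b'⟩, c, c'⟩
      exact ⟨⟨fun i => by linarith [a i, b i], fun i => by linarith [a' i, b' i]⟩,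
        fun i => by linarith [c i], fun i => by linarith [c' i]⟩
    · rintro ⟨⟨a, b⟩, c, c'⟩
      exact ⟨⟨⟨fun i => by linarith [a i], fun i => by linarith [a i]⟩,
        fun i => by linarith [b i], fun i => by linarith [b i]⟩,
        fun i => by linarith [c i], fun i => by linarith [c' i]⟩
  let v := (LinearMap.fst ℝ (Fin s → ℝ) (Fin r → ℝ)).toAffineMap.comp p
  refine ⟨n, M, k, LinearMap.toMatrix' v.linear, v 0, fun z hz => ?_, fun hi z V l hl hV hT => ?_⟩
  · obtain ⟨a, b, c⟩ := (hM' z).1 hz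
    rw [LinearMap.toMatrix'_mulVec]
    have h := congrFun (AffineMap.decomp v) z
    have h' : v.linear z + v 0 = (p z).1 := h.symm
    rw [h']
    exact ⟨c, (p z).2, b, a⟩
  · rw [hM']
    have hp : p z = (V, l) := by
      rw [← hL hi (V, l), hT, ← hw]; rfl
    rw [hp]
    exact ⟨hT, hl, hV⟩



/-- The unique minimizer `U⁰(z)` of `(1/2)UᵀHU` (with `H ≻ 0`)
over `{U : GU ≤ W + Sz}` is piecewise affine over a finite cover of the
feasible set `X₀` by polyhedral critical regions `CRⁱ = {z : Hⁱz ≤ kⁱ} ∩ X₀`. -/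
theorem parametric_qp_minimizer_piecewise_affine (s r d : ℕ)
    (H : Matrix (Fin s) (Fin s) ℝ) (hH : H.PosDef)
    (G : Matrix (Fin r) (Fin s) ℝ) (S : Matrix (Fin r) (Fin d) ℝ)
    (W : Fin r → ℝ)
    (U0 : (Fin d → ℝ) → (Fin s → ℝ))
    (hU0 : ∀ z : Fin d → ℝ, (∃ U : Fin s → ℝ, G.mulVec U ≤ W + S.mulVec z) →
      G.mulVec (U0 z) ≤ W + S.mulVec z ∧
      ∀ U : Fin s → ℝ, G.mulVec U ≤ W + S.mulVec z →
        (1 / 2) * ((U0 z) ⬝ᵥ H.mulVec (U0 z)) ≤ (1 / 2) * (U ⬝ᵥ H.mulVec U)) :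
    ∃ (Nr : ℕ) (rows : Fin Nr → ℕ)
      (Hs : (i : Fin Nr) → Matrix (Fin (rows i)) (Fin d) ℝ)
      (ks : (i : Fin Nr) → Fin (rows i) → ℝ)
      (Fs : Fin Nr → Matrix (Fin s) (Fin d) ℝ)
      (gs : Fin Nr → (Fin s → ℝ)),
      (∀ z : Fin d → ℝ, (∃ U : Fin s → ℝ, G.mulVec U ≤ W + S.mulVec z) →
        ∃ i : Fin Nr, (Hs i).mulVec z ≤ ks i) ∧
      (∀ (i : Fin Nr) (z : Fin d → ℝ),
        (∃ U : Fin s → ℝ, G.mulVec U ≤ W + S.mulVec z) →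
        (Hs i).mulVec z ≤ ks i →
        U0 z = (Fs i).mulVec z + gs i) := by
  choose n M k F g h1 h2 using pqp_region d H G S W
  let e := Fintype.equivFin (Finset (Fin r))
  refine ⟨_, fun i => n (e.symm i), fun i => M (e.symm i), fun i => k (e.symm i),
    fun i => F (e.symm i), fun i => g (e.symm i), fun z hz => ?_, fun i z hz hi => ?_⟩
  · obtain ⟨hf, hm⟩ := hU0 z hz
    obtain ⟨B, l, hl, hT, hinj⟩ := pqp_indep H hH G (U0 z) (W + S.mulVec z) hf
      (fun U hU => by linarith [hm U hU])
    refine ⟨e B, ?_⟩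
    have h := h2 B hinj z _ l hl hf hT
    rw [← e.symm_apply_apply B] at h
    exact h
  · obtain ⟨hf, hm⟩ := hU0 z hz
    obtain ⟨hV, l, hl, hT⟩ := h1 _ z hi
    exact pqp_suff H hH G _ _ _ l _ hT hl hf (by linarith [hm _ hV])
end
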